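/- arXiv:2005.09852 — 7 statements merged into one kernel-verified Lean document; each statement's English description precedes it below -/
import Mathlib

section
/- For every integer d ≥ 2 and every integer c with 1 ≤ c ≤ 2d−2 one has a_{c,d} = 0; moreover a_{2d−1,d} = 2·(−1)^{d−1} for every integer d ≥ 2, and a_{2d,d} = (−1)^{d−1}·(2d−1) for every integer d ≥ 1. Consequently, for every integer N' ≥ 1 the N'×N' matrices A_1 = (a_{2i−1,j})_{1≤i,j≤N'} and A_2 = (a_{2i,j})_{1≤i,j≤N'} are lower triangular with all diagonal entries nonzero, hence invertible over ℚ. -/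
/-- The defining rules for the integers `a c d` (`c, d ≥ 1`):
`a_{c,1} = 1` for `c ≥ 1`; `a_{1,d} = a_{2,d} = 0` for `d ≥ 2`;
`a_{3,2} = -2` and `a_{3,d} = 0` for `d ≥ 3`;
`a_{c+2,d+1} = a_{c+1,d+1} - a_{c,d}` for `c ≥ 2`, `d ≥ 1`. -/
def aRules (a : ℕ → ℕ → ℤ) : Prop :=
  (∀ c, 1 ≤ c → a c 1 = 1) ∧
  (∀ d, 2 ≤ d → a 1 d = 0) ∧
  (∀ d, 2 ≤ d → a 2 d = 0) ∧
  a 3 2 = -2 ∧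
  (∀ d, 3 ≤ d → a 3 d = 0) ∧
  (∀ c, 2 ≤ c → ∀ d, 1 ≤ d → a (c + 2) (d + 1) = a (c + 1) (d + 1) - a c d)

theorem Matrix.isUnit_of_lowerTriangular {n K : Type*} [Fintype n] [LinearOrder n] [Field K]
    (M : Matrix n n K) (h : ∀ i j, i < j → M i j = 0) (hdiag : ∀ i, M i i ≠ 0) : IsUnit M := by
  rw [Matrix.isUnit_iff_isUnit_det, Matrix.det_of_isLowerTriangular M fun i j hij => h i j hij,
    isUnit_iff_ne_zero]
  exact Finset.prod_ne_zero_iff.mpr fun i _ => hdiag i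

namespace aRules

variable {a : ℕ → ℕ → ℤ}

theorem eq_zero (ha : aRules a) {d c : ℕ} (hd : 2 ≤ d) (hc : 1 ≤ c) (hcd : c ≤ 2 * d - 2) :
    a c d = 0 := by
  obtain ⟨-, h1, h2, -, h3, hrec⟩ := ha
  induction d, hd using Nat.le_induction generalizing c with
  | base =>
    obtain rfl | rfl : c = 1 ∨ c = 2 := by omega
    exacts [h1 2 le_rfl, h2 2 le_rfl]
  | succ d hd ihd =>
    induction c, hc using Nat.le_induction with
    | base => exact h1 _ (by omega)
    | succ c hc ihc =>
      obtain rfl | rfl | hc3 : c = 1 ∨ c = 2 ∨ 3 ≤ c := by omega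
      · exact h2 _ (by omega)
      · exact h3 _ (by omega)
      · obtain ⟨k, rfl⟩ : ∃ k, c = k + 1 := ⟨c - 1, by omega⟩
        rw [hrec k (by omega) d (by omega), ihc (by omega), ihd (by omega) (by omega), sub_zero]

theorem apply_two_mul_sub_one (ha : aRules a) {d : ℕ} (hd : 2 ≤ d) :
    a (2 * d - 1) d = 2 * (-1) ^ (d - 1) := by
  induction d, hd using Nat.le_induction with
  | base => simpa using ha.2.2.2.1
  | succ d hd ih =>
    obtain ⟨k, rfl⟩ : ∃ k, d = k + 1 := ⟨d - 1, by omega⟩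
    have hrec := ha.2.2.2.2.2 (2 * (k + 1) - 1) (by omega) (k + 1) (by omega)
    rw [ha.eq_zero (d := k + 1 + 1) (c := 2 * (k + 1) - 1 + 1) (by omega) (by omega) (by omega),
      ih] at hrec
    rw [show 2 * (k + 1 + 1) - 1 = 2 * (k + 1) - 1 + 2 by omega, hrec]
    simp only [Nat.add_sub_cancel]
    ring

theorem apply_two_mul (ha : aRules a) {d : ℕ} (hd : 1 ≤ d) :
    a (2 * d) d = (-1) ^ (d - 1) * (2 * (d : ℤ) - 1) := by
  induction d, hd using Nat.le_induction with
  | base => simpa using ha.1 2 (by omega)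
  | succ d hd ih =>
    obtain ⟨k, rfl⟩ : ∃ k, d = k + 1 := ⟨d - 1, by omega⟩
    have hrec := ha.2.2.2.2.2 (2 * (k + 1)) (by omega) (k + 1) (by omega)
    have hodd := ha.apply_two_mul_sub_one (d := k + 1 + 1) (by omega)
    rw [show 2 * (k + 1 + 1) - 1 = 2 * (k + 1) + 1 by omega] at hodd
    rw [hodd, ih] at hrec
    rw [show 2 * (k + 1 + 1) = 2 * (k + 1) + 2 by omega, hrec]
    simp only [Nat.add_sub_cancel]
    push_cast
    ring

theorem apply_odd_ne_zero (ha : aRules a) (i : ℕ) : a (2 * i + 1) (i + 1) ≠ 0 := by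
  obtain rfl | hi := Nat.eq_zero_or_pos i
  · simp [ha.1 1 le_rfl]
  · rw [show 2 * i + 1 = 2 * (i + 1) - 1 by omega, ha.apply_two_mul_sub_one (by omega)]
    simp

theorem apply_even_ne_zero (ha : aRules a) (i : ℕ) : a (2 * i + 2) (i + 1) ≠ 0 := by
  rw [show 2 * i + 2 = 2 * (i + 1) by omega, ha.apply_two_mul (by omega)]
  exact mul_ne_zero (by simp) (by omega)

end aRules

/-- Vanishing above the "diagonal", the values on the two relevant diagonals, and the
consequence that the matrices `A₁ = (a_{2i-1,j})` and `A₂ = (a_{2i,j})` (1-based indices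
`1 ≤ i, j ≤ N'`) are lower triangular with nonzero diagonal, hence invertible over `ℚ`. -/
theorem a_vanishing_and_matrices_invertible (a : ℕ → ℕ → ℤ) (ha : aRules a) :
    (∀ d, 2 ≤ d → ∀ c, 1 ≤ c → c ≤ 2 * d - 2 → a c d = 0) ∧
    (∀ d, 2 ≤ d → a (2 * d - 1) d = 2 * (-1 : ℤ) ^ (d - 1)) ∧
    (∀ d, 1 ≤ d → a (2 * d) d = (-1 : ℤ) ^ (d - 1) * (2 * (d : ℤ) - 1)) ∧
    (∀ N' : ℕ, 1 ≤ N' →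
      ∀ A₁ A₂ : Matrix (Fin N') (Fin N') ℚ,
        (∀ i j : Fin N', A₁ i j = ((a (2 * (i : ℕ) + 1) ((j : ℕ) + 1) : ℤ) : ℚ)) →
        (∀ i j : Fin N', A₂ i j = ((a (2 * (i : ℕ) + 2) ((j : ℕ) + 1) : ℤ) : ℚ)) →
        (∀ i j : Fin N', i < j → A₁ i j = 0) ∧
        (∀ i j : Fin N', i < j → A₂ i j = 0) ∧
        (∀ i : Fin N', A₁ i i ≠ 0) ∧
        (∀ i : Fin N', A₂ i i ≠ 0) ∧
        IsUnit A₁ ∧ IsUnit A₂) := by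
  refine ⟨fun d hd c hc hcd => ha.eq_zero hd hc hcd, fun d hd => ha.apply_two_mul_sub_one hd,
    fun d hd => ha.apply_two_mul hd, fun N' _ A₁ A₂ h₁ h₂ => ?_⟩
  have hlow₁ : ∀ i j : Fin N', i < j → A₁ i j = 0 := fun i j hij => by
    rw [h₁, ha.eq_zero (by omega) (by omega) (by omega), Int.cast_zero]
  have hlow₂ : ∀ i j : Fin N', i < j → A₂ i j = 0 := fun i j hij => by
    rw [h₂, ha.eq_zero (by omega) (by omega) (by omega), Int.cast_zero]
  have hdiag₁ : ∀ i : Fin N', A₁ i i ≠ 0 := fun i => by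
    rw [h₁]
    exact Int.cast_ne_zero.mpr (ha.apply_odd_ne_zero i)
  have hdiag₂ : ∀ i : Fin N', A₂ i i ≠ 0 := fun i => by
    rw [h₂]
    exact Int.cast_ne_zero.mpr (ha.apply_even_ne_zero i)
  exact ⟨hlow₁, hlow₂, hdiag₁, hdiag₂, A₁.isUnit_of_lowerTriangular hlow₁ hdiag₁,
    A₂.isUnit_of_lowerTriangular hlow₂ hdiag₂⟩
end

section
/- Let K be a field, let i ≥ 2 be an integer, and let a_{p,q} ∈ K be given for 2 ≤ p ≤ i, 2 ≤ q ≤ i with a_{p,q} = 0 whenever q > p and a_{q,q} ≠ 0 for all 2 ≤ q ≤ i. Let M be the (i−1)×(i−1) matrix whose first column consists entirely of 1's and whose (p,q) entry for q ≥ 2 is a_{p+1,q}. Then det(M)/(a_{2,2}·⋯·a_{i,i}) = ∑_{j=2}^{i} (−1)^j · D_{i,j}/(a_{j,j}·⋯·a_{i,i}), where for j < i, D_{i,j} is the determinant of the (i−j)×(i−j) matrix whose (p,q) entry is a_{j+p, j+q−1} for 1 ≤ p, q ≤ i−j, and D_{i,i} := 1 (the empty determinant). -/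
/-- The determinant of the matrix with a first column of ones and remaining columns
`a (s + p) (s + q - 1)`, expanded along its first row `1, a s s, 0, …, 0`. -/
theorem det_ones_column_succ {K : Type*} [CommRing K] (a : ℕ → ℕ → K) (s n : ℕ)
    (hrow : ∀ q, s < q → q ≤ s + n → a s q = 0) :
    Matrix.det (Matrix.of fun p q : Fin (n + 2) =>
        if (q : ℕ) = 0 then 1 else a (s + p) (s + q - 1)) =
      Matrix.det (Matrix.of fun p q : Fin (n + 1) => a (s + p + 1) (s + q)) -
        a s s * Matrix.det (Matrix.of fun p q : Fin (n + 1) =>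
          if (q : ℕ) = 0 then 1 else a (s + 1 + p) (s + 1 + q - 1)) := by
  rw [Matrix.det_succ_row_zero, Fin.sum_univ_succ, Fin.sum_univ_succ, Finset.sum_eq_zero]
  · have hD : (Matrix.of fun p q : Fin (n + 2) =>
        if (q : ℕ) = 0 then (1 : K) else a (s + p) (s + q - 1)).submatrix
          Fin.succ (Fin.succAbove 0) =
        Matrix.of fun p q : Fin (n + 1) => a (s + p + 1) (s + q) := by
      ext p q
      simp [← add_assoc]
    have hF : (Matrix.of fun p q : Fin (n + 2) =>
        if (q : ℕ) = 0 then (1 : K) else a (s + p) (s + q - 1)).submatrix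
          Fin.succ (Fin.succAbove (Fin.succ 0)) =
        Matrix.of fun p q : Fin (n + 1) =>
          if (q : ℕ) = 0 then 1 else a (s + 1 + p) (s + 1 + q - 1) := by
      ext p q
      refine Fin.cases ?_ (fun q => ?_) q
      · simp
      · simp only [Matrix.submatrix_apply, Matrix.of_apply, Fin.succ_succAbove_succ,
          Fin.succAbove_zero, Fin.val_succ, Nat.succ_ne_zero, if_false]
        congr 1 <;> omega
    rw [hD, hF]
    simp [sub_eq_add_neg]
  · intro q _
    have hz : a s (s + (q + 1)) = 0 := hrow _ (by omega) (by omega)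
    simp [hz]

/-- The determinant with a first column of ones, divided by the product of the diagonal entries,
as an alternating sum of quotients of trailing determinants. -/
theorem det_ones_column_div {K : Type*} [Field K] (a : ℕ → ℕ → K) (n s : ℕ)
    (htri : ∀ p q, s ≤ p → p < q → q ≤ s + n → a p q = 0)
    (hdiag : ∀ q, s ≤ q → q ≤ s + n → a q q ≠ 0) :
    Matrix.det (Matrix.of fun p q : Fin (n + 1) =>
        if (q : ℕ) = 0 then 1 else a (s + p) (s + q - 1)) /
        ∏ t ∈ Finset.Icc s (s + n), a t t =
      ∑ j ∈ Finset.Icc s (s + n), (-1 : K) ^ (s + j) *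
        Matrix.det (Matrix.of fun p q : Fin (s + n - j) => a (j + p + 1) (j + q)) /
          ∏ t ∈ Finset.Icc j (s + n), a t t := by
  induction n generalizing s with
  | zero =>
    have : IsEmpty (Fin (s + 0 - s)) := ⟨fun x => by have := x.isLt; omega⟩
    simp [Matrix.det_unique, Matrix.det_isEmpty, ← two_mul]
  | succ n ih =>
    have hs : s ≤ s + (n + 1) := by omega
    have hI : Finset.Icc s (s + (n + 1)) = insert s (Finset.Icc (s + 1) (s + 1 + n)) := by
      ext x
      simp only [Finset.mem_Icc, Finset.mem_insert]
      omega
    have hs' : s ∉ Finset.Icc (s + 1) (s + 1 + n) := by simp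
    have hss : a s s ≠ 0 := hdiag s le_rfl hs
    have hn : s + (n + 1) = s + 1 + n := by omega
    have hprod : ∏ t ∈ Finset.Icc (s + 1) (s + 1 + n), a t t ≠ 0 := by
      refine Finset.prod_ne_zero_iff.2 fun t ht => ?_
      rw [Finset.mem_Icc] at ht
      exact hdiag t (by omega) (by omega)
    have ih' := ih (s + 1) (fun p q h₁ h₂ h₃ => htri p q (by omega) h₂ (by omega))
      (fun q h₁ h₂ => hdiag q (by omega) (by omega))
    have hsum : ∑ j ∈ Finset.Icc (s + 1) (s + 1 + n), (-1 : K) ^ (s + j) *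
        Matrix.det (Matrix.of fun p q : Fin (s + (n + 1) - j) => a (j + p + 1) (j + q)) /
          ∏ t ∈ Finset.Icc j (s + (n + 1)), a t t =
        -(Matrix.det (Matrix.of fun p q : Fin (n + 1) =>
          if (q : ℕ) = 0 then 1 else a (s + 1 + p) (s + 1 + q - 1)) /
          ∏ t ∈ Finset.Icc (s + 1) (s + 1 + n), a t t) := by
      rw [ih', hn, ← Finset.sum_neg_distrib]
      refine Finset.sum_congr rfl fun j _ => ?_
      ring
    have hlead : Matrix.det (Matrix.of fun p q : Fin (s + (n + 1) - s) =>
        a (s + p + 1) (s + q)) =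
        Matrix.det (Matrix.of fun p q : Fin (n + 1) => a (s + p + 1) (s + q)) := by
      rw [Nat.add_sub_cancel_left]
    rw [det_ones_column_succ a s n fun q h₁ h₂ => htri s q le_rfl h₁ (by omega)]
    conv_rhs => rw [hI, Finset.sum_insert hs', hsum, hlead]
    rw [hI, Finset.prod_insert hs', ← two_mul, pow_mul, neg_one_sq, one_pow]
    field_simp
    ring

/-- Let `a p q ∈ K` for `2 ≤ p, q ≤ i` be "lower triangular with nonzero diagonal" data, and
let `M` be the `(i-1)×(i-1)` matrix whose first column is all `1`'s and whose `(p,q)` entry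
for `q ≥ 2` is `a (p+1) q` (1-based indices).  Then
`det M / (a_{2,2} ⋯ a_{i,i}) = ∑_{j=2}^{i} (-1)^j · D_{i,j} / (a_{j,j} ⋯ a_{i,i})`,
where `D_{i,j}` (for `j < i`) is the determinant of the `(i-j)×(i-j)` matrix with `(p,q)`
entry `a (j+p) (j+q-1)` (1-based `p, q`), and `D_{i,i} = 1` is the empty determinant. -/
theorem det_div_eq_sum_det_div {K : Type*} [Field K] (i : ℕ) (hi : 2 ≤ i)
    (a : ℕ → ℕ → K)
    (htri : ∀ p q, 2 ≤ p → p ≤ i → 2 ≤ q → q ≤ i → p < q → a p q = 0)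
    (hdiag : ∀ q, 2 ≤ q → q ≤ i → a q q ≠ 0)
    (M : Matrix (Fin (i - 1)) (Fin (i - 1)) K)
    (hM : ∀ p q : Fin (i - 1),
      M p q = if (q : ℕ) = 0 then 1 else a ((p : ℕ) + 2) ((q : ℕ) + 1)) :
    Matrix.det M / ∏ t ∈ Finset.Icc 2 i, a t t =
      ∑ j ∈ Finset.Icc 2 i,
        (-1 : K) ^ j *
          (Matrix.det (Matrix.of fun p q : Fin (i - j) =>
            a (j + (p : ℕ) + 1) (j + (q : ℕ)))) /
          ∏ t ∈ Finset.Icc j i, a t t := by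
  obtain ⟨n, rfl⟩ := Nat.exists_eq_add_of_le hi
  have hcard : 2 + n - 1 = n + 1 := by omega
  have hdet : M.det = Matrix.det (Matrix.of fun p q : Fin (n + 1) =>
      if (q : ℕ) = 0 then 1 else a (2 + p) (2 + q - 1)) := by
    rw [← Matrix.det_reindex_self (finCongr hcard) M]
    congr 1
    ext p q
    simp only [Matrix.reindex_apply, Matrix.submatrix_apply, Matrix.of_apply, hM]
    simp [add_comm]
  rw [hdet, det_ones_column_div a n 2
    (fun p q h₁ h₂ h₃ => htri p q h₁ (by omega) (by omega) h₃ h₂) hdiag]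
  simp [pow_add]
end

section
/- Fix an integer N ≥ 2 and set N' := ⌊N/2⌋. Let A_1 = (a_{2i−1,j})_{1≤i,j≤N'} and A_2 = (a_{2i,j})_{1≤i,j≤N'}, which are invertible lower triangular matrices over ℚ. For a complex number s with Re(s) > 2, let z_1(s) := (Z_0(s)/2, Z_2(s), Z_4(s), …, Z_{2N'−2}(s))^T and z_2(s) := (Z_1(s), Z_3(s), …, Z_{2N'−1}(s))^T. Then for every s with Re(s) > 2 one has A_1^{−1}·z_1(s) = A_2^{−1}·z_2(s). -/
/-- The Euler–Zagier double zeta function `ζ(-c, s+c) = ∑_{m,n ≥ 1} m^c / (m+n)^(s+c)`. -/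
noncomputable def Z (c : ℕ) (s : ℂ) : ℂ :=
  ∑' p : ℕ+ × ℕ+, ((p.1 : ℕ) : ℂ) ^ c / ((((p.1 : ℕ) + (p.2 : ℕ) : ℕ)) : ℂ) ^ (s + (c : ℂ))

open Finset in
/-- The rows of `a` expand the power sums `x ^ c + y ^ c` in powers of `x * y` when `x + y = 1`. -/
theorem aRules.sum_eq_powerSum {a : ℕ → ℕ → ℤ} (ha : aRules a) {x y : ℂ} (hxy : x + y = 1)
    (c K : ℕ) (hK : (c + 1) / 2 < K) :
    ∑ d ∈ range K, (a (c + 2) (d + 1) : ℂ) * (x * y) ^ d = x ^ (c + 1) + y ^ (c + 1) := by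
  obtain ⟨h1, -, h22, h32, h33, hrec⟩ := ha
  induction c using Nat.twoStepInduction generalizing K with
  | zero =>
    obtain ⟨K, rfl⟩ : ∃ k, K = k + 1 := ⟨K - 1, by omega⟩
    rw [sum_range_succ', sum_eq_zero fun d _ => by rw [h22 (d + 1 + 1) (by omega)]; simp,
      h1 _ (by omega)]
    simp [hxy]
  | one =>
    obtain ⟨K, rfl⟩ : ∃ k, K = k + 1 + 1 := ⟨K - 2, by omega⟩
    rw [sum_range_succ', sum_range_succ',
      sum_eq_zero fun d _ => by rw [h33 (d + 1 + 1 + 1) (by omega)]; simp, h1 _ (by omega), h32]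
    push_cast
    linear_combination (-1 - x - y) * hxy
  | more c ih₀ ih₁ =>
    obtain ⟨K, rfl⟩ : ∃ k, K = k + 1 := ⟨K - 1, by omega⟩
    have e₀ := ih₀ K (by omega)
    have e₁ := ih₁ (K + 1) (by omega)
    rw [sum_range_succ', h1 _ (by omega)] at e₁ ⊢
    have key : ∑ d ∈ range K, (a (c + 1 + 1 + 2) (d + 1 + 1) : ℂ) * (x * y) ^ (d + 1) =
        ∑ d ∈ range K, (a (c + 1 + 2) (d + 1 + 1) : ℂ) * (x * y) ^ (d + 1) -
          x * y * ∑ d ∈ range K, (a (c + 2) (d + 1) : ℂ) * (x * y) ^ d := by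
      rw [mul_sum, ← sum_sub_distrib]
      refine sum_congr rfl fun d _ => ?_
      rw [show c + 1 + 1 + 2 = c + 2 + 2 by omega, hrec (c + 2) (by omega) (d + 1) (by omega)]
      push_cast
      ring
    rw [key, e₀]
    linear_combination e₁ - (x ^ (c + 2) + y ^ (c + 2)) * hxy

theorem aRules.eq_zero_s7 {a : ℕ → ℕ → ℤ} (ha : aRules a) (c d : ℕ) (h : c + 2 < 2 * d) :
    a (c + 1) d = 0 := by
  obtain ⟨-, h12, h22, -, h33, hrec⟩ := ha
  induction c using Nat.strong_induction_on generalizing d with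
  | _ c ih =>
    match c, ih, h with
    | 0, _, h => exact h12 d (by omega)
    | 1, _, h => exact h22 d (by omega)
    | 2, _, h => exact h33 d (by omega)
    | c + 3, ih, h =>
      obtain ⟨d, rfl⟩ : ∃ k, d = k + 1 := ⟨d - 1, by omega⟩
      rw [show c + 3 + 1 = c + 2 + 2 by omega, hrec (c + 2) (by omega) d (by omega),
        ih (c + 2) (by omega) (d + 1) (by omega), ih (c + 1) (by omega) d (by omega), sub_zero]

theorem aRules.diag_eq {a : ℕ → ℕ → ℤ} (ha : aRules a) (i : ℕ) :
    a (2 * i + 2) (i + 1) = (-1) ^ i * (2 * i + 1) ∧ a (2 * i + 3) (i + 2) = (-1) ^ (i + 1) * 2 := by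
  have hz := ha.eq_zero_s7
  obtain ⟨h1, -, -, h32, -, hrec⟩ := ha
  induction i with
  | zero => simp [h1, h32]
  | succ i ih =>
    have e₁ := hrec (2 * i + 2) (by omega) (i + 1) (by omega)
    have e₂ := hrec (2 * i + 3) (by omega) (i + 2) (by omega)
    rw [ih.2, ih.1] at e₁
    rw [ih.2, hz (2 * i + 3) (i + 2 + 1) (by omega)] at e₂
    refine ⟨?_, ?_⟩
    · rw [show 2 * (i + 1) + 2 = 2 * i + 2 + 2 by omega, e₁]
      push_cast
      ring
    · rw [show 2 * (i + 1) + 3 = 2 * i + 3 + 2 by omega, e₂]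
      ring

theorem summable_mul_add_cpow_neg {s : ℂ} (hs : 2 < s.re) {f : ℕ+ × ℕ+ → ℂ} (hf : ∀ p, ‖f p‖ ≤ 1) :
    Summable fun p : ℕ+ × ℕ+ => f p * (((p.1 : ℕ) + (p.2 : ℕ) : ℕ) : ℂ) ^ (-s) := by
  have h : Summable fun n : ℕ+ => ((n : ℕ) : ℝ) ^ (-(s.re / 2)) :=
    (Real.summable_nat_rpow.2 (by linarith)).comp_injective PNat.coe_injective
  refine Summable.of_norm_bounded
    (h.mul_of_nonneg h (fun _ => by positivity) fun _ => by positivity) fun p => ?_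
  have hm : (0 : ℝ) < (p.1 : ℕ) := mod_cast p.1.pos
  have hn : (0 : ℝ) < (p.2 : ℕ) := mod_cast p.2.pos
  rw [norm_mul, Complex.norm_natCast_cpow_of_pos (by positivity), Complex.neg_re]
  refine (mul_le_of_le_one_left (by positivity) (hf p)).trans ?_
  push_cast
  rw [show -s.re = -(s.re / 2) + -(s.re / 2) by ring, Real.rpow_add (by positivity)]
  gcongr ?_ * ?_ <;>
    exact Real.rpow_le_rpow_of_nonpos (by assumption) (by linarith) (by linarith)

theorem PNat.norm_div_add_le_one (m n : ℕ+) : ‖((m : ℕ) : ℂ) / ((m : ℕ) + (n : ℕ) : ℕ)‖ ≤ 1 := by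
  rw [norm_div, Complex.norm_natCast, Complex.norm_natCast]
  exact div_le_one_of_le₀ (by push_cast; linarith [(n : ℕ).cast_nonneg (α := ℝ)]) (by positivity)

theorem PNat.norm_div_add_le_one' (m n : ℕ+) : ‖((n : ℕ) : ℂ) / ((m : ℕ) + (n : ℕ) : ℕ)‖ ≤ 1 := by
  rw [add_comm]
  exact PNat.norm_div_add_le_one n m

theorem Z_eq_tsum_pow (c : ℕ) (s : ℂ) :
    Z c s = ∑' p : ℕ+ × ℕ+, (((p.1 : ℕ) : ℂ) / ((p.1 : ℕ) + (p.2 : ℕ) : ℕ)) ^ c *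
      (((p.1 : ℕ) + (p.2 : ℕ) : ℕ) : ℂ) ^ (-s) := by
  refine tsum_congr fun p => ?_
  have hk : (((p.1 : ℕ) + (p.2 : ℕ) : ℕ) : ℂ) ≠ 0 := Nat.cast_ne_zero.2 (by positivity)
  rw [Complex.cpow_add _ _ hk, Complex.cpow_natCast, Complex.cpow_neg, div_pow,
    div_mul_eq_div_div, div_right_comm, div_eq_mul_inv _ (_ ^ s)]

theorem Z_eq_tsum_pow_swap (c : ℕ) (s : ℂ) :
    Z c s = ∑' p : ℕ+ × ℕ+, (((p.2 : ℕ) : ℂ) / ((p.1 : ℕ) + (p.2 : ℕ) : ℕ)) ^ c *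
      (((p.1 : ℕ) + (p.2 : ℕ) : ℕ) : ℂ) ^ (-s) := by
  rw [Z_eq_tsum_pow, ← (Equiv.prodComm ℕ+ ℕ+).tsum_eq]
  refine tsum_congr fun p => ?_
  simp [add_comm]

/-- Half of the sum `∑_{m,n ≥ 1} (m n)^j / (m+n)^(s+2j)`. -/
noncomputable def halfSymmSum (s : ℂ) (j : ℕ) : ℂ :=
  (∑' p : ℕ+ × ℕ+, ((((p.1 : ℕ) : ℂ) / ((p.1 : ℕ) + (p.2 : ℕ) : ℕ)) *
    (((p.2 : ℕ) : ℂ) / ((p.1 : ℕ) + (p.2 : ℕ) : ℕ))) ^ j *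
      (((p.1 : ℕ) + (p.2 : ℕ) : ℕ) : ℂ) ^ (-s)) / 2

theorem aRules.Z_eq_sum {a : ℕ → ℕ → ℤ} (ha : aRules a) {s : ℂ} (hs : 2 < s.re)
    (c K : ℕ) (hK : (c + 1) / 2 < K) :
    Z (c + 1) s = ∑ d ∈ Finset.range K, (a (c + 2) (d + 1) : ℂ) * halfSymmSum s d := by
  have hx (p : ℕ+ × ℕ+) := PNat.norm_div_add_le_one p.1 p.2
  have hy (p : ℕ+ × ℕ+) := PNat.norm_div_add_le_one' p.1 p.2
  have two_mul_Z : 2 * Z (c + 1) s = 2 * ∑ d ∈ Finset.range K,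
      (a (c + 2) (d + 1) : ℂ) * halfSymmSum s d := by
    rw [two_mul]
    nth_rw 1 [Z_eq_tsum_pow]
    rw [Z_eq_tsum_pow_swap, ← Summable.tsum_add
      (summable_mul_add_cpow_neg hs fun p => by
        rw [norm_pow]; exact pow_le_one₀ (norm_nonneg _) (hx p))
      (summable_mul_add_cpow_neg hs fun p => by
        rw [norm_pow]; exact pow_le_one₀ (norm_nonneg _) (hy p)), Finset.mul_sum]
    simp only [halfSymmSum]
    simp_rw [mul_left_comm (2 : ℂ), mul_div_cancel₀ _ (two_ne_zero : (2 : ℂ) ≠ 0), ← tsum_mul_left]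
    rw [← Summable.tsum_finsetSum fun d _ => Summable.mul_left _
      (summable_mul_add_cpow_neg hs fun p => by
        rw [norm_pow, norm_mul]
        exact pow_le_one₀ (by positivity) (mul_le_one₀ (hx p) (norm_nonneg _) (hy p)))]
    refine tsum_congr fun p => ?_
    have hk : (((p.1 : ℕ) + (p.2 : ℕ) : ℕ) : ℂ) ≠ 0 := Nat.cast_ne_zero.2 (by positivity)
    rw [← add_mul, ← ha.sum_eq_powerSum (by rw [← add_div, ← Nat.cast_add, div_self hk]) c K hK,
      Finset.sum_mul]
    simp_rw [mul_assoc]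
  exact mul_left_cancel₀ two_ne_zero two_mul_Z

theorem Z_zero_div_two (s : ℂ) : Z 0 s / 2 = halfSymmSum s 0 := by
  simp [Z_eq_tsum_pow, halfSymmSum]

theorem Matrix.isUnit_det_of_lowerTriangular {n K : Type*} [Fintype n] [LinearOrder n] [Field K]
    (A : Matrix n n K)
    (h : ∀ i j, i < j → A i j = 0) (hd : ∀ i, A i i ≠ 0) : IsUnit A.det := by
  rw [Matrix.det_of_isLowerTriangular A fun i j hij => h i j hij, isUnit_iff_ne_zero]
  exact Finset.prod_ne_zero_iff.2 fun i _ => hd i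

theorem Matrix.inv_mulVec_eq_of_eq_mulVec {n R : Type*} [Fintype n] [DecidableEq n] [CommRing R]
    {A : Matrix n n R} (h : IsUnit A.det) {v w : n → R} (hv : v = A.mulVec w) : A⁻¹.mulVec v = w := by
  rw [hv, Matrix.mulVec_mulVec, Matrix.nonsing_inv_mul _ h, Matrix.one_mulVec]

/-- For `N ≥ 2`, `N' = ⌊N/2⌋`, `A₁ = (a_{2i-1,j})`, `A₂ = (a_{2i,j})` (1-based
`1 ≤ i, j ≤ N'`), `z₁(s) = (Z₀(s)/2, Z₂(s), …, Z_{2N'-2}(s))ᵀ` and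
`z₂(s) = (Z₁(s), Z₃(s), …, Z_{2N'-1}(s))ᵀ`, one has
`A₁⁻¹ · z₁(s) = A₂⁻¹ · z₂(s)` for every `s` with `Re s > 2`. -/
theorem inv_matrix_relation (a : ℕ → ℕ → ℤ) (ha : aRules a)
    (N : ℕ) (hN : 2 ≤ N)
    (A₁ A₂ : Matrix (Fin (N / 2)) (Fin (N / 2)) ℂ)
    (hA₁ : ∀ i j : Fin (N / 2), A₁ i j = ((a (2 * (i : ℕ) + 1) ((j : ℕ) + 1) : ℤ) : ℂ))
    (hA₂ : ∀ i j : Fin (N / 2), A₂ i j = ((a (2 * (i : ℕ) + 2) ((j : ℕ) + 1) : ℤ) : ℂ))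
    (s : ℂ) (hs : 2 < s.re) :
    A₁⁻¹.mulVec (fun k : Fin (N / 2) => if (k : ℕ) = 0 then Z 0 s / 2 else Z (2 * (k : ℕ)) s) =
      A₂⁻¹.mulVec (fun k : Fin (N / 2) => Z (2 * (k : ℕ) + 1) s) := by
  have hinv₁ : IsUnit A₁.det := by
    refine A₁.isUnit_det_of_lowerTriangular (fun i j hij => ?_) fun i => ?_
    · rw [hA₁, ha.eq_zero_s7 _ _ (by have : (i : ℕ) < j := hij; omega), Int.cast_zero]
    · rw [hA₁, Int.cast_ne_zero]
      rcases (i : ℕ) with _ | k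
      · simp [ha.1]
      · rw [show 2 * (k + 1) + 1 = 2 * k + 3 by omega, (ha.diag_eq k).2]
        simp
  have hinv₂ : IsUnit A₂.det := by
    refine A₂.isUnit_det_of_lowerTriangular (fun i j hij => ?_) fun i => ?_
    · rw [hA₂, ha.eq_zero_s7 _ _ (by have : (i : ℕ) < j := hij; omega), Int.cast_zero]
    · rw [hA₂, Int.cast_ne_zero, (ha.diag_eq i).1]
      exact mul_ne_zero (by simp) (by omega)
  rw [Matrix.inv_mulVec_eq_of_eq_mulVec hinv₁ (w := fun j => halfSymmSum s j),
    Matrix.inv_mulVec_eq_of_eq_mulVec hinv₂ (w := fun j => halfSymmSum s j)]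
  · funext i
    rw [ha.Z_eq_sum hs _ (N / 2) (by omega), Finset.sum_range]
    simp [Matrix.mulVec, dotProduct, hA₂]
  · funext i
    simp only [Matrix.mulVec, dotProduct, hA₁]
    rw [← Finset.sum_range fun j => (a (2 * (i : ℕ) + 1) (j + 1) : ℂ) * halfSymmSum s j]
    split_ifs with hi
    · rw [hi, Z_zero_div_two, Finset.sum_eq_single_of_mem 0 (by simp; omega) fun j _ hj => by
        rw [ha.2.1 _ (by omega)]; simp]
      simp [ha.1]
    · obtain ⟨c, hc⟩ : ∃ c, 2 * (i : ℕ) = c + 1 := ⟨2 * i - 1, by omega⟩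
      rw [hc, ha.Z_eq_sum hs c (N / 2) (by omega)]
end

section
/- Let m be a positive integer and suppose c_0, c_1, …, c_{2m+1} are complex numbers such that c_{2m+1}·Z_{2m+1}(s) + c_{2m}·Z_{2m}(s) + ⋯ + c_1·Z_1(s) + c_0·Z_0(s)/2 = 0 for every complex number s with Re(s) > 2. Then c_0 + c_1 + c_2 + ⋯ + c_{2m+1} = 0. -/
/-- The polynomial `F` with `∑_{m < N} (m / N) ^ k = N * F (1 / N)` given by Faulhaber's formula. -/
noncomputable def faulhaberPoly (k : ℕ) : Polynomial ℂ :=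
  ∑ i ∈ Finset.range (k + 1),
    Polynomial.C ((bernoulli i * (k + 1).choose i / (k + 1) : ℚ) : ℂ) * Polynomial.X ^ i

lemma sum_range_div_pow (k : ℕ) {N : ℕ} (hN : N ≠ 0) :
    ∑ m ∈ Finset.range N, ((m : ℂ) / N) ^ k = N * (faulhaberPoly k).eval (N : ℂ)⁻¹ := by
  have hN' : (N : ℂ) ≠ 0 := Nat.cast_ne_zero.mpr hN
  have h : ∑ m ∈ Finset.range N, (m : ℂ) ^ k = ∑ i ∈ Finset.range (k + 1),
      (bernoulli i : ℂ) * ((k + 1).choose i) * (N : ℂ) ^ (k + 1 - i) / (k + 1) := by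
    exact_mod_cast congrArg (Rat.cast : ℚ → ℂ) (sum_range_pow N k)
  simp only [div_pow]
  rw [← Finset.sum_div, h, faulhaberPoly, Polynomial.eval_finsetSum, Finset.sum_div,
    Finset.mul_sum]
  refine Finset.sum_congr rfl fun i hi ↦ ?_
  have hik : i ≤ k := Nat.lt_succ_iff.mp (Finset.mem_range.mp hi)
  have hp : (N : ℂ) ^ (k + 1 - i) = N * N ^ k * (N : ℂ)⁻¹ ^ i := by
    rw [pow_sub₀ _ hN' (by omega), pow_succ', inv_pow]
  have hk : (k : ℂ) + 1 ≠ 0 := Nat.cast_add_one_ne_zero k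
  simp only [Polynomial.eval_mul, Polynomial.eval_C, Polynomial.eval_pow, Polynomial.eval_X]
  rw [hp]
  push_cast
  field_simp

lemma coeff_one_faulhaberPoly (k : ℕ) :
    (faulhaberPoly k).coeff 1 = if k = 0 then 0 else -1 / 2 := by
  simp only [faulhaberPoly, Polynomial.finsetSum_coeff, Polynomial.coeff_C_mul_X_pow]
  rw [Finset.sum_ite_eq]
  rcases eq_or_ne k 0 with rfl | hk
  · simp
  · have hk' : (k : ℂ) + 1 ≠ 0 := Nat.cast_add_one_ne_zero k
    have : 1 ∈ Finset.range (k + 1) := Finset.mem_range.mpr (by omega)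
    simp only [this, hk, if_true, if_false, bernoulli_one, Nat.choose_one_right]
    push_cast
    field_simp

/-- The coefficients of `Z k` as a Dirichlet series. -/
noncomputable def zCoeff (k N : ℕ) : ℂ := ∑ m ∈ Finset.Ioo 0 N, ((m : ℂ) / N) ^ k

lemma zCoeff_eq (k : ℕ) {N : ℕ} (hN : N ≠ 0) :
    zCoeff k N = N * (faulhaberPoly k).eval (N : ℂ)⁻¹ - if k = 0 then 1 else 0 := by
  have hI : Finset.range N = insert 0 (Finset.Ioo 0 N) := by
    ext a; simp only [Finset.mem_range, Finset.mem_insert, Finset.mem_Ioo]; omega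
  rw [← sum_range_div_pow k hN, hI, Finset.sum_insert (by simp), zCoeff]
  simp [zero_pow_eq]

lemma sum_add_eq_zero_of_sum_zCoeff_eq_zero {n : ℕ} {d : ℕ → ℂ}
    (h : ∀ N ≠ 0, ∑ k ∈ Finset.range (n + 1), d k * zCoeff k N = 0) :
    ∑ k ∈ Finset.range (n + 1), d k + d 0 = 0 := by
  set Q : Polynomial ℂ := ∑ k ∈ Finset.range (n + 1), Polynomial.C (d k) * faulhaberPoly k
    - Polynomial.C (d 0) * Polynomial.X with hQ
  have hroot (N : ℕ) : Q.IsRoot ((N + 1 : ℕ) : ℂ)⁻¹ := by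
    have hN : ((N + 1 : ℕ) : ℂ) ≠ 0 := Nat.cast_ne_zero.mpr N.succ_ne_zero
    have := h (N + 1) N.succ_ne_zero
    simp only [zCoeff_eq _ N.succ_ne_zero, mul_sub, Finset.sum_sub_distrib, mul_ite, mul_one,
      mul_zero, Finset.sum_ite_eq', Finset.mem_range, Nat.succ_pos, if_true] at this
    simp only [Polynomial.IsRoot, hQ, Polynomial.eval_sub, Polynomial.eval_finsetSum,
      Polynomial.eval_mul, Polynomial.eval_C, Polynomial.eval_X]
    apply mul_left_cancel₀ hN
    rw [mul_sub, Finset.mul_sum, mul_zero, mul_left_comm, mul_inv_cancel₀ hN, mul_one, ← this]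
    congr 1
    exact Finset.sum_congr rfl fun _ _ ↦ mul_left_comm _ _ _
  have hQ0 : Q = 0 := by
    refine Polynomial.eq_zero_of_infinite_isRoot Q
      ((Set.infinite_range_of_injective (f := fun N : ℕ ↦ ((N + 1 : ℕ) : ℂ)⁻¹) ?_).mono ?_)
    · intro a b hab
      simpa using hab
    · rintro _ ⟨N, rfl⟩
      exact hroot N
  have h1 := congrArg (Polynomial.coeff · 1) hQ0
  simp only [hQ, Polynomial.coeff_sub, Polynomial.finsetSum_coeff, Polynomial.coeff_C_mul,
    coeff_one_faulhaberPoly, Polynomial.coeff_X_one, Polynomial.coeff_zero] at h1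
  rw [Finset.sum_range_succ'] at h1 ⊢
  simp only [Nat.succ_ne_zero, if_false, if_true, ← Finset.sum_mul] at h1
  linear_combination -2 * h1

lemma summable_Z_term (k : ℕ) {x : ℝ} (hx : 4 ≤ x) :
    Summable fun p : ℕ+ × ℕ+ ↦
      ((p.1 : ℕ) : ℂ) ^ k / ((((p.1 : ℕ) + (p.2 : ℕ) : ℕ)) : ℂ) ^ ((x : ℂ) + (k : ℂ)) := by
  have hs : Summable fun n : ℕ+ ↦ 1 / ((n : ℕ) : ℝ) ^ 2 :=
    (Real.summable_one_div_nat_pow.mpr one_lt_two).comp_injective PNat.coe_injective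
  have hs2 := hs.mul_of_nonneg hs (fun _ ↦ by positivity) (fun _ ↦ by positivity)
  refine Summable.of_norm_bounded hs2 ?_
  rintro ⟨a, b⟩
  have ha : (1 : ℝ) ≤ (a : ℕ) := mod_cast a.pos
  have hb : (1 : ℝ) ≤ (b : ℕ) := mod_cast b.pos
  have hpos : 0 < (a : ℕ) + (b : ℕ) := by positivity
  rw [norm_div, norm_pow, Complex.norm_natCast, Complex.norm_natCast_cpow_of_pos hpos]
  simp only [Complex.add_re, Complex.ofReal_re, Complex.natCast_re]
  push_cast
  set u : ℝ := ((a : ℕ) : ℝ)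
  set v : ℝ := ((b : ℕ) : ℝ)
  rw [Real.rpow_add (by positivity), Real.rpow_natCast, one_div_mul_one_div_rev,
    div_le_div_iff₀ (by positivity) (by positivity)]
  have h1 : (u + v) ^ 4 ≤ (u + v) ^ x := by
    rw [← Real.rpow_natCast]
    exact Real.rpow_le_rpow_of_exponent_le (by linarith) (by exact_mod_cast hx)
  have h2 : v ^ 2 * u ^ 2 ≤ (u + v) ^ 4 := by
    calc v ^ 2 * u ^ 2 ≤ (u + v) ^ 2 * (u + v) ^ 2 := by gcongr <;> linarith
      _ = _ := by ring
  have h3 : u ^ k ≤ (u + v) ^ k := by gcongr; linarith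
  calc u ^ k * (v ^ 2 * u ^ 2) ≤ (u + v) ^ k * (u + v) ^ x := by
        gcongr; exact h2.trans h1
    _ = _ := by ring

lemma LSeriesHasSum_zCoeff (k : ℕ) {x : ℝ} (hx : 4 ≤ x) :
    LSeriesHasSum (zCoeff k) x (Z k x) := by
  have h := (summable_Z_term k hx).hasSum.tsum_fiberwise fun p ↦ (p.1 : ℕ) + (p.2 : ℕ)
  refine Eq.subst (motive := fun f ↦ HasSum f (Z k x)) (funext fun N ↦ ?_) h
  let e : Finset.Ioo 0 N ≃
      ((fun p : ℕ+ × ℕ+ ↦ (p.1 : ℕ) + (p.2 : ℕ)) ⁻¹' {N} : Set (ℕ+ × ℕ+)) :=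
    { toFun := fun m ↦ ⟨(⟨m, (Finset.mem_Ioo.mp m.2).1⟩,
          ⟨N - m, Nat.sub_pos_of_lt (Finset.mem_Ioo.mp m.2).2⟩),
          Nat.add_sub_cancel' (Finset.mem_Ioo.mp m.2).2.le⟩
      invFun := fun p ↦ ⟨p.1.1, Finset.mem_Ioo.mpr ⟨p.1.1.pos, by
        have h1 : (p.1.1 : ℕ) + (p.1.2 : ℕ) = N := p.2
        have h2 := p.1.2.pos
        omega⟩⟩
      left_inv := fun m ↦ rfl
      right_inv := fun p ↦ by
        have h1 : (p.1.1 : ℕ) + (p.1.2 : ℕ) = N := p.2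
        refine Subtype.ext (Prod.ext rfl (PNat.eq ?_))
        change N - (p.1.1 : ℕ) = p.1.2
        omega }
  rw [← e.tsum_eq, tsum_fintype]
  rcases eq_or_ne N 0 with rfl | hN
  · rw [LSeries.term_zero]
    exact Finset.sum_eq_zero fun b _ ↦ absurd b.2 (by simp)
  have hN' : (N : ℂ) ≠ 0 := Nat.cast_ne_zero.mpr hN
  rw [LSeries.term_of_ne_zero hN, zCoeff, Finset.sum_div, ← Finset.sum_coe_sort (Finset.Ioo 0 N)]
  refine Finset.sum_congr rfl fun m _ ↦ ?_
  have hm : (m : ℕ) + (N - m) = N := Nat.add_sub_cancel' (Finset.mem_Ioo.mp m.2).2.le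
  change ((m : ℕ) : ℂ) ^ k / (((m : ℕ) + (N - m) : ℕ) : ℂ) ^ ((x : ℂ) + k) = _
  rw [hm, Complex.cpow_add _ _ hN', Complex.cpow_natCast, div_pow, div_div, mul_comm]

/-- If `∑_{k=1}^{2m+1} c_k Z_k(s) + c_0 Z_0(s)/2 = 0` for all `s` with `Re s > 2`,
then `c_0 + c_1 + ⋯ + c_{2m+1} = 0`. -/
theorem sum_coeff_eq_zero (m : ℕ) (hm : 1 ≤ m) (c : ℕ → ℂ)
    (h : ∀ s : ℂ, 2 < s.re →
      (∑ k ∈ Finset.Icc 1 (2 * m + 1), c k * Z k s) + c 0 * Z 0 s / 2 = 0) :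
    ∑ k ∈ Finset.range (2 * m + 2), c k = 0 := by
  let d : ℕ → ℂ := fun k ↦ if k = 0 then c 0 / 2 else c k
  have hsplit (g : ℕ → ℂ) : ∑ k ∈ Finset.range (2 * m + 1 + 1), d k * g k =
      ∑ k ∈ Finset.Icc 1 (2 * m + 1), c k * g k + c 0 * g 0 / 2 := by
    have hI : Finset.range (2 * m + 1 + 1) = insert 0 (Finset.Icc 1 (2 * m + 1)) := by
      ext a; simp only [Finset.mem_range, Finset.mem_insert, Finset.mem_Icc]; omega
    rw [hI, Finset.sum_insert (by simp), add_comm]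
    congr 1
    · refine Finset.sum_congr rfl fun k hk ↦ ?_
      have : k ≠ 0 := by have := (Finset.mem_Icc.mp hk).1; omega
      simp [d, this]
    · simp only [d, if_true]; ring
  have hL {x : ℝ} (hx : 4 ≤ x) :
      LSeriesHasSum (∑ k ∈ Finset.range (2 * m + 1 + 1), d k • zCoeff k) x 0 := by
    rw [← h x (by rw [Complex.ofReal_re]; linarith), ← hsplit fun k ↦ Z k x]
    exact LSeriesHasSum.sum fun k _ ↦ (LSeriesHasSum_zCoeff k hx).smul (d k)
  have hev : (fun x : ℝ ↦ LSeries (∑ k ∈ Finset.range (2 * m + 1 + 1), d k • zCoeff k) x)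
      =ᶠ[Filter.atTop] 0 := by
    filter_upwards [Filter.eventually_ge_atTop 4] with x hx using (hL hx).LSeries_eq
  have habs := (hL le_rfl).LSeriesSummable.abscissaOfAbsConv_le.trans_lt (EReal.coe_lt_top _)
  have hcoeff := (LSeries_eventually_eq_zero_iff'.mp hev).resolve_right habs.ne
  have key : ∑ k ∈ Finset.range (2 * m + 1 + 1), d k + d 0 = 0 :=
    sum_add_eq_zero_of_sum_zCoeff_eq_zero fun N hN ↦ by simpa using hcoeff N hN
  rw [Finset.sum_range_succ'] at key ⊢
  simp only [d, Nat.succ_ne_zero, if_false, if_true] at key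
  linear_combination key
end

section
/- For every complex number s with Re(s) > 2, one has Z_7(s) = (7/2)·Z_6(s) − (35/4)·Z_4(s) + (21/2)·Z_2(s) − (17/8)·Z_0(s). -/
/-- The pairs of positive integers `(m, n)` give a summable family
`m^c / (m+n)^(s+c)` when `Re s > 2`. -/
theorem summable_doubleZeta_term (c : ℕ) {s : ℂ} (hs : 2 < s.re) :
    Summable fun p : ℕ+ × ℕ+ =>
      ((p.1 : ℕ) : ℂ) ^ c / ((((p.1 : ℕ) + (p.2 : ℕ) : ℕ)) : ℂ) ^ (s + (c : ℂ)) := by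
  have h1 : Summable fun m : ℕ+ => ((m : ℕ) : ℝ) ^ (-(s.re / 2)) :=
    (Real.summable_nat_rpow.2 (by linarith)).comp_injective PNat.coe_injective
  have h2 := h1.mul_of_nonneg h1 (fun _ => by positivity) (fun _ => by positivity)
  refine Summable.of_norm_bounded h2 fun ⟨m, n⟩ => ?_
  have hm : (0 : ℝ) < (m : ℕ) := by exact_mod_cast m.pos
  have hn : (0 : ℝ) < (n : ℕ) := by exact_mod_cast n.pos
  have hN : (0 : ℝ) < ((m : ℕ) : ℝ) + (n : ℕ) := by positivity
  have hnorm : ‖((((m : ℕ) + (n : ℕ) : ℕ)) : ℂ) ^ (s + (c : ℂ))‖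
      = (((m : ℕ) : ℝ) + (n : ℕ)) ^ s.re * (((m : ℕ) : ℝ) + (n : ℕ)) ^ c := by
    rw [Complex.norm_natCast_cpow_of_pos (by positivity)]
    simp only [Complex.add_re, Complex.natCast_re, Nat.cast_add]
    rw [Real.rpow_add hN, Real.rpow_natCast]
  simp only [norm_div, norm_pow, Complex.norm_natCast, hnorm]
  have hpow : ((m : ℕ) : ℝ) ^ c ≤ (((m : ℕ) : ℝ) + (n : ℕ)) ^ c := by
    gcongr
    linarith
  calc ((m : ℕ) : ℝ) ^ c / ((((m : ℕ) : ℝ) + (n : ℕ)) ^ s.re * (((m : ℕ) : ℝ) + (n : ℕ)) ^ c)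
      ≤ ((((m : ℕ) : ℝ) + (n : ℕ)) ^ s.re)⁻¹ := by
        rw [div_le_iff₀ (by positivity), inv_mul_cancel_left₀ (by positivity)]
        exact hpow
    _ = (((m : ℕ) : ℝ) + (n : ℕ)) ^ (-(s.re / 2)) * (((m : ℕ) : ℝ) + (n : ℕ)) ^ (-(s.re / 2)) := by
        rw [← Real.rpow_add hN, ← Real.rpow_neg hN.le]
        ring_nf
    _ ≤ ((m : ℕ) : ℝ) ^ (-(s.re / 2)) * ((n : ℕ) : ℝ) ^ (-(s.re / 2)) := by
        gcongr ?_ * ?_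
        · exact Real.rpow_le_rpow_of_nonpos hm (by linarith) (by linarith)
        · exact Real.rpow_le_rpow_of_nonpos hn (by linarith) (by linarith)

/-- The sum over a product `α × α` of a function that is odd under swapping vanishes. -/
theorem tsum_eq_zero_of_swap_eq_neg {α : Type*} (g : α × α → ℂ) (hg : ∀ p, g p.swap = -g p) :
    ∑' p, g p = 0 := by
  have h : ∑' p, g p = -∑' p, g p := by
    rw [← tsum_neg, ← (Equiv.prodComm α α).tsum_eq g]
    exact tsum_congr hg
  exact self_eq_neg.1 h

theorem zeta_neg_seven_relation (s : ℂ) (hs : 2 < s.re) :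
    Z 7 s = (7 / 2) * Z 6 s - (35 / 4) * Z 4 s + (21 / 2) * Z 2 s - (17 / 8) * Z 0 s := by
  have H := fun c => (summable_doubleZeta_term c hs).hasSum
  have key := ((((H 7).sub ((H 6).mul_left (7 / 2))).add ((H 4).mul_left (35 / 4))).sub
    ((H 2).mul_left (21 / 2))).add ((H 0).mul_left (17 / 8))
  have hzero := key.tsum_eq
  rw [tsum_eq_zero_of_swap_eq_neg] at hzero
  · unfold Z
    linear_combination -hzero
  · rintro ⟨m, n⟩
    have hN : (((n : ℕ) : ℂ) + (m : ℕ)) ≠ 0 := by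
      exact_mod_cast (Nat.add_pos_left n.pos m).ne'
    have hs0 : (((n : ℕ) : ℂ) + (m : ℕ)) ^ s ≠ 0 := by simp [Complex.cpow_eq_zero_iff, hN]
    simp only [Prod.swap_prod_mk, Nat.cast_add, add_comm ((m : ℕ) : ℂ) ((n : ℕ) : ℂ),
      Complex.cpow_add _ _ hN, Complex.cpow_natCast]
    field_simp
    ring
end

section
/- For every complex number s with Re(s) > 2, one has Z_9(s) = (9/2)·Z_8(s) − 21·Z_6(s) + 63·Z_4(s) − (153/2)·Z_2(s) + (31/2)·Z_0(s). -/
/-- The summand of `Z c s`. -/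
noncomputable def zetaTerm (c : ℕ) (s : ℂ) (p : ℕ+ × ℕ+) : ℂ :=
  ((p.1 : ℕ) : ℂ) ^ c / ((((p.1 : ℕ) + (p.2 : ℕ) : ℕ)) : ℂ) ^ (s + (c : ℂ))

lemma zetaTerm_eq (c : ℕ) (s : ℂ) (p : ℕ+ × ℕ+) :
    zetaTerm c s p = (((p.1 : ℕ) : ℂ) / (((p.1 : ℕ) : ℂ) + ((p.2 : ℕ) : ℂ))) ^ c *
      ((((p.1 : ℕ) + (p.2 : ℕ) : ℕ)) : ℂ) ^ (-s) := by
  have hN : ((((p.1 : ℕ) + (p.2 : ℕ) : ℕ)) : ℂ) ≠ 0 :=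
    Nat.cast_ne_zero.mpr (by have := p.1.pos; omega)
  rw [zetaTerm, Complex.cpow_add _ _ hN, Complex.cpow_natCast, Complex.cpow_neg, div_pow,
    ← Nat.cast_add]
  have hs : ((((p.1 : ℕ) + (p.2 : ℕ) : ℕ)) : ℂ) ^ s ≠ 0 := fun h =>
    hN ((Complex.cpow_eq_zero_iff _ _).mp h).1
  field_simp

lemma summable_pnat_rpow_mul {r : ℝ} (hr : 1 < r) :
    Summable fun p : ℕ+ × ℕ+ => ((p.1 : ℕ) : ℝ) ^ (-r) * ((p.2 : ℕ) : ℝ) ^ (-r) := by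
  have h : Summable fun n : ℕ+ => ((n : ℕ) : ℝ) ^ (-r) :=
    (Real.summable_nat_rpow.mpr (by linarith)).comp_injective PNat.coe_injective
  exact h.mul_of_nonneg h (fun n => by positivity) (fun n => by positivity)

lemma summable_zetaTerm (c : ℕ) {s : ℂ} (hs : 2 < s.re) : Summable (zetaTerm c s) := by
  refine Summable.of_norm_bounded (summable_pnat_rpow_mul (r := s.re / 2) (by linarith)) ?_
  intro p
  have h1 : (1 : ℝ) ≤ ((p.1 : ℕ) : ℝ) := Nat.one_le_cast.mpr p.1.pos
  have h2 : (1 : ℝ) ≤ ((p.2 : ℕ) : ℝ) := Nat.one_le_cast.mpr p.2.pos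
  rw [zetaTerm_eq, norm_mul, Complex.norm_natCast_cpow_of_pos (by have := p.1.pos; omega),
    norm_pow, norm_div, ← Nat.cast_add, Complex.norm_natCast, Complex.norm_natCast]
  push_cast
  generalize ((p.1 : ℕ) : ℝ) = a at *
  generalize ((p.2 : ℕ) : ℝ) = b at *
  have hle : (a / (a + b)) ^ c ≤ 1 :=
    pow_le_one₀ (by positivity) ((div_le_one (by positivity)).mpr (by linarith))
  have hsq : (a + b) ^ (-s).re = ((a + b) ^ 2) ^ (-(s.re / 2)) := by
    rw [← Real.rpow_natCast (a + b) 2, ← Real.rpow_mul (by positivity)]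
    congr 1
    simp
    ring
  calc (a / (a + b)) ^ c * (a + b) ^ (-s).re
      ≤ (a + b) ^ (-s).re := mul_le_of_le_one_left (by positivity) hle
    _ = ((a + b) ^ 2) ^ (-(s.re / 2)) := hsq
    _ ≤ (a * b) ^ (-(s.re / 2)) :=
        Real.rpow_le_rpow_of_nonpos (by positivity) (by nlinarith) (by linarith)
    _ = a ^ (-(s.re / 2)) * b ^ (-(s.re / 2)) :=
        Real.mul_rpow (by positivity) (by positivity)

lemma hasSum_zetaTerm (c : ℕ) {s : ℂ} (hs : 2 < s.re) : HasSum (zetaTerm c s) (Z c s) :=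
  (summable_zetaTerm c hs).hasSum

lemma HasSum.eq_zero_of_swap_neg {α : Type*} {g : α × α → ℂ} {a : ℂ} (hg : HasSum g a)
    (hswap : ∀ p, g p.swap = -g p) : a = 0 := by
  have h : HasSum (fun p => -g p) a := by
    simpa only [Function.comp_def, Equiv.prodComm_apply, hswap] using
      (Equiv.prodComm α α).hasSum_iff.mpr hg
  exact self_eq_neg.mp (h.unique hg.neg)

theorem zeta_neg_nine_relation (s : ℂ) (hs : 2 < s.re) :
    Z 9 s = (9 / 2) * Z 8 s - 21 * Z 6 s + 63 * Z 4 s - (153 / 2) * Z 2 s + (31 / 2) * Z 0 s := by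
  have h := (hasSum_zetaTerm 9 hs).sub ((((((hasSum_zetaTerm 8 hs).mul_left (9 / 2)).sub
    ((hasSum_zetaTerm 6 hs).mul_left 21)).add ((hasSum_zetaTerm 4 hs).mul_left 63)).sub
    ((hasSum_zetaTerm 2 hs).mul_left (153 / 2))).add ((hasSum_zetaTerm 0 hs).mul_left (31 / 2)))
  refine sub_eq_zero.mp (h.eq_zero_of_swap_neg fun p => ?_)
  have hN : ((p.1 : ℕ) : ℂ) + ((p.2 : ℕ) : ℂ) ≠ 0 := by
    rw [← Nat.cast_add]
    exact Nat.cast_ne_zero.mpr (by have := p.1.pos; omega)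
  have hx : ((p.2 : ℕ) : ℂ) / (((p.1 : ℕ) : ℂ) + ((p.2 : ℕ) : ℂ)) =
      1 - ((p.1 : ℕ) : ℂ) / (((p.1 : ℕ) : ℂ) + ((p.2 : ℕ) : ℂ)) := by
    field_simp
    ring
  simp only [zetaTerm_eq, Prod.fst_swap, Prod.snd_swap]
  rw [add_comm ((p.2 : ℕ) : ℂ), add_comm (p.2 : ℕ), hx]
  ring
end

section
/- For every complex number s with Re(s) > 2, one has Z_11(s) = (11/2)·Z_10(s) − (165/4)·Z_8(s) + 231·Z_6(s) − (2805/4)·Z_4(s) + (1705/2)·Z_2(s) − (691/4)·Z_0(s). -/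
open Finset in
/-- Faulhaber-type relation between the power sums `∑_{m < n} m ^ c`. -/
theorem sum_range_pow_eleven_relation (n : ℕ) :
    ∑ i ∈ range n, ((i : ℂ) + 1) ^ 11 =
      ∑ i ∈ range n, ((11 / 2) * ((i : ℂ) + 1) ^ 10 * (n + 1)
        - (165 / 4) * ((i : ℂ) + 1) ^ 8 * (n + 1) ^ 3 + 231 * ((i : ℂ) + 1) ^ 6 * (n + 1) ^ 5
        - (2805 / 4) * ((i : ℂ) + 1) ^ 4 * (n + 1) ^ 7
        + (1705 / 2) * ((i : ℂ) + 1) ^ 2 * (n + 1) ^ 9 - (691 / 4) * (n + 1) ^ 11) := by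
  have h2 : ∀ n : ℕ, ∑ i ∈ range n, ((i : ℂ) + 1) ^ 2 =
      (n : ℂ) * ((n : ℂ) + 1) * (2 * n + 1) / 6 := by
    intro n
    induction n with
    | zero => simp
    | succ k ih => rw [sum_range_succ, ih]; push_cast; ring
  have h4 : ∀ n : ℕ, ∑ i ∈ range n, ((i : ℂ) + 1) ^ 4 =
      (n : ℂ) ^ 5 / 5 + (n : ℂ) ^ 4 / 2 + (n : ℂ) ^ 3 / 3 - (n : ℂ) / 30 := by
    intro n
    induction n with
    | zero => simp
    | succ k ih => rw [sum_range_succ, ih]; push_cast; ring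
  have h6 : ∀ n : ℕ, ∑ i ∈ range n, ((i : ℂ) + 1) ^ 6 =
      (n : ℂ) ^ 7 / 7 + (n : ℂ) ^ 6 / 2 + (n : ℂ) ^ 5 / 2 - (n : ℂ) ^ 3 / 6 + (n : ℂ) / 42 := by
    intro n
    induction n with
    | zero => simp
    | succ k ih => rw [sum_range_succ, ih]; push_cast; ring
  have h8 : ∀ n : ℕ, ∑ i ∈ range n, ((i : ℂ) + 1) ^ 8 =
      (n : ℂ) ^ 9 / 9 + (n : ℂ) ^ 8 / 2 + 2 * (n : ℂ) ^ 7 / 3 - 7 * (n : ℂ) ^ 5 / 15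
        + 2 * (n : ℂ) ^ 3 / 9 - (n : ℂ) / 30 := by
    intro n
    induction n with
    | zero => simp
    | succ k ih => rw [sum_range_succ, ih]; push_cast; ring
  have h10 : ∀ n : ℕ, ∑ i ∈ range n, ((i : ℂ) + 1) ^ 10 =
      (n : ℂ) ^ 11 / 11 + (n : ℂ) ^ 10 / 2 + 5 * (n : ℂ) ^ 9 / 6 - (n : ℂ) ^ 7
        + (n : ℂ) ^ 5 - (n : ℂ) ^ 3 / 2 + 5 * (n : ℂ) / 66 := by
    intro n
    induction n with
    | zero => simp
    | succ k ih => rw [sum_range_succ, ih]; push_cast; ring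
  have h11 : ∀ n : ℕ, ∑ i ∈ range n, ((i : ℂ) + 1) ^ 11 =
      (n : ℂ) ^ 12 / 12 + (n : ℂ) ^ 11 / 2 + 11 * (n : ℂ) ^ 10 / 12 - 11 * (n : ℂ) ^ 8 / 8
        + 11 * (n : ℂ) ^ 6 / 6 - 11 * (n : ℂ) ^ 4 / 8 + 5 * (n : ℂ) ^ 2 / 12 := by
    intro n
    induction n with
    | zero => simp
    | succ k ih => rw [sum_range_succ, ih]; push_cast; ring
  simp only [sum_add_distrib, sum_sub_distrib, ← sum_mul, ← mul_sum, h2, h4, h6, h8, h10, h11,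
    sum_const, card_range, nsmul_eq_mul]
  ring

/-- The summand of the double zeta series, indexed from zero. -/
noncomputable def doubleZetaTerm (c : ℕ) (s : ℂ) (p : ℕ × ℕ) : ℂ :=
  ((p.1 : ℂ) + 1) ^ c / ((p.1 + p.2 + 2 : ℕ) : ℂ) ^ (s + (c : ℂ))

theorem Z_eq_tsum_doubleZetaTerm (c : ℕ) (s : ℂ) : Z c s = ∑' p, doubleZetaTerm c s p := by
  rw [Z, ← (Equiv.prodCongr Equiv.pnatEquivNat Equiv.pnatEquivNat).symm.tsum_eq]
  refine tsum_congr fun p => ?_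
  simp only [doubleZetaTerm, Equiv.prodCongr_symm, Equiv.prodCongr_apply, Prod.map,
    Equiv.pnatEquivNat_symm_apply, Nat.succPNat_coe, Nat.succ_eq_add_one]
  rw [show p.1 + 1 + (p.2 + 1) = p.1 + p.2 + 2 by ring]
  push_cast
  rfl

theorem norm_doubleZetaTerm_le (c : ℕ) {s : ℂ} (hs : 0 ≤ s.re) (p : ℕ × ℕ) :
    ‖doubleZetaTerm c s p‖ ≤
      ((p.1 + 1 : ℕ) : ℝ) ^ (-(s.re / 2)) * ((p.2 + 1 : ℕ) : ℝ) ^ (-(s.re / 2)) := by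
  obtain ⟨i, j⟩ := p
  have hN : (0 : ℝ) < ((i + j + 2 : ℕ) : ℝ) := by positivity
  rw [doubleZetaTerm, norm_div, norm_pow, Complex.norm_natCast_cpow_of_pos (by positivity),
    Complex.add_re, Complex.natCast_re, Real.rpow_add hN, Real.rpow_natCast,
    show ‖((i : ℂ) + 1)‖ = (i : ℝ) + 1 by
      rw [← Nat.cast_succ, Complex.norm_natCast]; push_cast; rfl,
    ← Real.mul_rpow (by positivity) (by positivity), Real.rpow_neg (by positivity)]
  have h1 : (((i + 1 : ℕ) : ℝ) * ((j + 1 : ℕ) : ℝ)) ^ (s.re / 2) ≤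
      ((i + j + 2 : ℕ) : ℝ) ^ s.re := by
    calc _ ≤ (((i + j + 2 : ℕ) : ℝ) ^ 2) ^ (s.re / 2) := by
          refine Real.rpow_le_rpow (by positivity) ?_ (by positivity)
          push_cast
          nlinarith [Nat.cast_nonneg (α := ℝ) i, Nat.cast_nonneg (α := ℝ) j,
            mul_nonneg (Nat.cast_nonneg (α := ℝ) i) (Nat.cast_nonneg (α := ℝ) j)]
      _ = _ := by
          rw [← Real.rpow_natCast, ← Real.rpow_mul hN.le]
          congr 1
          push_cast
          ring
  have h2 : ((i : ℝ) + 1) ^ c ≤ ((i + j + 2 : ℕ) : ℝ) ^ c := by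
    gcongr
    push_cast
    linarith [Nat.cast_nonneg (α := ℝ) j]
  calc _ ≤ ((i + j + 2 : ℕ) : ℝ) ^ c /
        (((i + j + 2 : ℕ) : ℝ) ^ s.re * ((i + j + 2 : ℕ) : ℝ) ^ c) := by gcongr
    _ = (((i + j + 2 : ℕ) : ℝ) ^ s.re)⁻¹ := by field_simp
    _ ≤ _ := by gcongr

theorem summable_doubleZetaTerm (c : ℕ) {s : ℂ} (hs : 2 < s.re) :
    Summable (doubleZetaTerm c s) := by
  have h : Summable fun n : ℕ => ((n + 1 : ℕ) : ℝ) ^ (-(s.re / 2)) :=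
    (summable_nat_add_iff 1).2 (Real.summable_nat_rpow.2 (by linarith))
  exact .of_norm_bounded
    (h.mul_of_nonneg h (fun _ => by positivity) fun _ => by positivity)
    (norm_doubleZetaTerm_le c (by linarith))

/-- Grouping the double zeta series by the value of `m + n`. -/
theorem hasSum_Z (c : ℕ) {s : ℂ} (hs : 2 < s.re) :
    HasSum (fun k : ℕ => ∑ i ∈ Finset.range (k + 1),
      ((i : ℂ) + 1) ^ c / ((k + 2 : ℕ) : ℂ) ^ (s + (c : ℂ))) (Z c s) := by
  have h := (summable_doubleZetaTerm c hs).hasSum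
  rw [← Z_eq_tsum_doubleZetaTerm, ← Finset.HasAntidiagonal.sigmaAntidiagonalEquivProd.hasSum_iff] at h
  convert h.sigma fun k => hasSum_fintype _ using 2 with k
  rw [Finset.univ_eq_attach,
    show (∑ b ∈ (Finset.HasAntidiagonal.antidiagonal k).attach,
      (doubleZetaTerm c s ∘ Finset.HasAntidiagonal.sigmaAntidiagonalEquivProd) ⟨k, b⟩) =
      ∑ b ∈ (Finset.HasAntidiagonal.antidiagonal k).attach, doubleZetaTerm c s b from rfl,
    Finset.sum_attach (Finset.HasAntidiagonal.antidiagonal k) (doubleZetaTerm c s),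
    Finset.Nat.sum_antidiagonal_eq_sum_range_succ_mk]
  refine Finset.sum_congr rfl fun i hi => ?_
  rw [doubleZetaTerm, Nat.add_sub_cancel' (Finset.mem_range_succ_iff.1 hi)]

theorem zeta_neg_eleven_relation (s : ℂ) (hs : 2 < s.re) :
    Z 11 s = (11 / 2) * Z 10 s - (165 / 4) * Z 8 s + 231 * Z 6 s - (2805 / 4) * Z 4 s + (1705 / 2) * Z 2 s - (691 / 4) * Z 0 s := by
  have h := ((((((hasSum_Z 10 hs).mul_left (11 / 2)).sub
    ((hasSum_Z 8 hs).mul_left (165 / 4))).add ((hasSum_Z 6 hs).mul_left 231)).sub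
    ((hasSum_Z 4 hs).mul_left (2805 / 4))).add ((hasSum_Z 2 hs).mul_left (1705 / 2))).sub
    ((hasSum_Z 0 hs).mul_left (691 / 4))
  refine (hasSum_Z 11 hs).tsum_eq.symm.trans ((tsum_congr fun k => ?_).trans h.tsum_eq)
  have hN : ((k + 2 : ℕ) : ℂ) ≠ 0 := by exact_mod_cast (by omega : k + 2 ≠ 0)
  have hr := sum_range_pow_eleven_relation (k + 1)
  rw [show ((k + 1 : ℕ) : ℂ) + 1 = ((k + 2 : ℕ) : ℂ) by push_cast; ring] at hr
  simp only [← Finset.sum_div, Complex.cpow_add _ _ hN, Complex.cpow_natCast, hr]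
  have hs0 : ((k + 2 : ℕ) : ℂ) ^ s ≠ 0 := fun h0 => hN ((Complex.cpow_eq_zero_iff _ _).1 h0).1
  generalize ((k + 2 : ℕ) : ℂ) ^ s = w at *
  generalize ((k + 2 : ℕ) : ℂ) = N at *
  simp only [Finset.sum_add_distrib, Finset.sum_sub_distrib, ← Finset.sum_mul, ← Finset.mul_sum,
    Finset.sum_const, pow_zero, Finset.card_range, nsmul_eq_mul]
  field_simp
end
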